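/- With dp as in the standard dynamic programming recurrence, the maximum of dp(i,j) over all cells equals the side length of the maximal all-ones square contained in the matrix. -/

import Mathlib

def hasSquare {m n : ℕ} (M : Fin m → Fin n → Bool) (k : ℕ) : Prop :=
  ∃ i j : ℕ, ∃ (hi : i + k ≤ m) (hj : j + k ≤ n),
    ∀ s, ∀ _ : s < k, ∀ t, ∀ _ : t < k, M ⟨i + s, by omega⟩ ⟨j + t, by omega⟩ = true

/-- The maximal-square dynamic programming recurrence. -/
def MaxSquareRec {m n : ℕ} (M : Fin m → Fin n → Bool) (dp : Fin m → Fin n → ℕ) : Prop :=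
  ∀ (i : Fin m) (j : Fin n),
      dp i j =
        if M i j = false then 0
        else if i.val = 0 ∨ j.val = 0 then 1
        else
          min (min (dp ⟨i.val - 1, Nat.lt_of_le_of_lt (Nat.sub_le _ _) i.isLt⟩ j)
                   (dp i ⟨j.val - 1, Nat.lt_of_le_of_lt (Nat.sub_le _ _) j.isLt⟩))
              (dp ⟨i.val - 1, Nat.lt_of_le_of_lt (Nat.sub_le _ _) i.isLt⟩
                  ⟨j.val - 1, Nat.lt_of_le_of_lt (Nat.sub_le _ _) j.isLt⟩) + 1

namespace MaxSquareRec

variable {m n : ℕ} {M : Fin m → Fin n → Bool} {dp : Fin m → Fin n → ℕ}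

lemma succ_le_iff (hdp : MaxSquareRec M dp) {k i j : ℕ} (hi : i < m) (hj : j < n) :
    k + 1 ≤ dp ⟨i, hi⟩ ⟨j, hj⟩ ↔
      M ⟨i, hi⟩ ⟨j, hj⟩ = true ∧ (i = 0 ∨ j = 0 → k = 0) ∧
        (i ≠ 0 → j ≠ 0 → k ≤ dp ⟨i - 1, by omega⟩ ⟨j, hj⟩ ∧
          k ≤ dp ⟨i, hi⟩ ⟨j - 1, by omega⟩ ∧ k ≤ dp ⟨i - 1, by omega⟩ ⟨j - 1, by omega⟩) := by
  rw [hdp]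
  split_ifs with h₁ h₂
  · simp [h₁]
  · have h₃ : M ⟨i, hi⟩ ⟨j, hj⟩ = true := by simpa using h₁
    simp only at h₂
    simp only [h₃, true_and]
    constructor
    · intro h
      exact ⟨fun _ => by omega, fun _ _ => by omega⟩
    · rintro ⟨h, -⟩
      simp [h h₂]
  · have h₃ : M ⟨i, hi⟩ ⟨j, hj⟩ = true := by simpa using h₁
    simp only [not_or] at h₂
    simp [h₃, h₂.1, h₂.2]

/-- `dp i j` is the side of the largest all-ones square with bottom-right corner `(i, j)`. -/
lemma le_iff (hdp : MaxSquareRec M dp) (k : ℕ) {i j : ℕ} (hi : i < m) (hj : j < n) :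
    k ≤ dp ⟨i, hi⟩ ⟨j, hj⟩ ↔
      k ≤ i + 1 ∧ k ≤ j + 1 ∧ ∀ a b, ∀ (ha : a ≤ i) (hb : b ≤ j), i < a + k → j < b + k →
        M ⟨a, by omega⟩ ⟨b, by omega⟩ = true := by
  induction k generalizing i j with
  | zero =>
    simp only [Nat.zero_le, true_and, true_iff]
    intros
    omega
  | succ k ih =>
    rw [hdp.succ_le_iff hi hj]
    constructor
    · rintro ⟨h₁, h₂, h₃⟩
      by_cases h₀ : i = 0 ∨ j = 0
      · have hk := h₂ h₀
        refine ⟨by omega, by omega, fun a b ha hb hak hbk => ?_⟩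
        obtain rfl : a = i := by omega
        obtain rfl : b = j := by omega
        exact h₁
      · obtain ⟨hu, hl, hd⟩ := h₃ (by omega) (by omega)
        obtain ⟨-, -, hu⟩ := (ih _ _).1 hu
        obtain ⟨-, -, hl⟩ := (ih _ _).1 hl
        obtain ⟨hdi, hdj, hd⟩ := (ih _ _).1 hd
        refine ⟨by omega, by omega, fun a b ha hb hak hbk => ?_⟩
        rcases ha.eq_or_lt with rfl | ha'
        · rcases hb.eq_or_lt with rfl | hb'
          · exact h₁
          · exact hl a b (by omega) (by omega) (by omega) (by omega)
        · rcases hb.eq_or_lt with rfl | hb'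
          · exact hu a b (by omega) (by omega) (by omega) (by omega)
          · exact hd a b (by omega) (by omega) (by omega) (by omega)
    · rintro ⟨h₁, h₂, h₃⟩
      refine ⟨h₃ i j le_rfl le_rfl (by omega) (by omega), by omega, fun hi₀ hj₀ => ?_⟩
      refine ⟨(ih _ _).2 ⟨by omega, by omega, fun a b ha hb hak hbk => ?_⟩,
        (ih _ _).2 ⟨by omega, by omega, fun a b ha hb hak hbk => ?_⟩,
        (ih _ _).2 ⟨by omega, by omega, fun a b ha hb hak hbk => ?_⟩⟩ <;>
      exact h₃ a b (by omega) (by omega) (by omega) (by omega)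

end MaxSquareRec

theorem stmt6 {m n : ℕ} (hm : 1 ≤ m) (hn : 1 ≤ n)
    (M : Fin m → Fin n → Bool) (dp : Fin m → Fin n → ℕ)
    (hdp : ∀ (i : Fin m) (j : Fin n),
      dp i j =
        if M i j = false then 0
        else if i.val = 0 ∨ j.val = 0 then 1
        else
          min (min (dp ⟨i.val - 1, Nat.lt_of_le_of_lt (Nat.sub_le _ _) i.isLt⟩ j)
                   (dp i ⟨j.val - 1, Nat.lt_of_le_of_lt (Nat.sub_le _ _) j.isLt⟩))
              (dp ⟨i.val - 1, Nat.lt_of_le_of_lt (Nat.sub_le _ _) i.isLt⟩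
                  ⟨j.val - 1, Nat.lt_of_le_of_lt (Nat.sub_le _ _) j.isLt⟩) + 1) :
    IsGreatest {k : ℕ | hasSquare M k}
      (Finset.univ.sup fun p : Fin m × Fin n => dp p.1 p.2) := by
  have hrec : MaxSquareRec M dp := hdp
  constructor
  · have : Nonempty (Fin m × Fin n) := ⟨⟨0, hm⟩, ⟨0, hn⟩⟩
    obtain ⟨⟨⟨i, hi⟩, ⟨j, hj⟩⟩, -, hmax⟩ := Finset.exists_mem_eq_sup Finset.univ
      Finset.univ_nonempty fun p : Fin m × Fin n => dp p.1 p.2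
    rw [hmax]
    obtain ⟨hki, hkj, hsq⟩ := (hrec.le_iff _ hi hj).1 le_rfl
    simp only [Set.mem_ofPred_eq]
    generalize dp ⟨i, hi⟩ ⟨j, hj⟩ = k at *
    exact ⟨i + 1 - k, j + 1 - k, by omega, by omega, fun s hs t ht =>
      hsq _ _ (by omega) (by omega) (by omega) (by omega)⟩
  · rintro k ⟨i, j, hi, hj, hsq⟩
    rcases Nat.eq_zero_or_pos k with rfl | hk
    · exact Nat.zero_le _
    have hle : k ≤ dp ⟨i + k - 1, by omega⟩ ⟨j + k - 1, by omega⟩ := by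
      refine (hrec.le_iff _ _ _).2 ⟨by omega, by omega, fun a b ha hb hak hbk => ?_⟩
      have hab := hsq (a - i) (by omega) (b - j) (by omega)
      simpa only [Nat.add_sub_cancel' (show i ≤ a by omega),
        Nat.add_sub_cancel' (show j ≤ b by omega)] using hab
    exact hle.trans (Finset.le_sup (f := fun p : Fin m × Fin n => dp p.1 p.2)
      (Finset.mem_univ (⟨i + k - 1, by omega⟩, ⟨j + k - 1, by omega⟩)))
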